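/- (Null Typing, Expected Runtimes, and PAST) Let M be a closed term of Λ⊕^cbv. Then ETime(M) = sup { w : there exists a derivation Π ⊳ ⊢_w M : 𝟘 } (as an equality in [0,∞]); consequently, M is positively almost surely terminating if and only if sup { w : there exists a derivation Π ⊳ ⊢_w M : 𝟘 } < ∞. -/

import Mathlib

open scoped ENNReal

namespace CbV

/-! ### Terms of the probabilistic call-by-value λ-calculus `Λ⊕^cbv` -/

mutual
inductive Val : Type
  | var : ℕ → Val
  | lam : ℕ → Tm → Val
inductive Tm : Type
  | val : Val → Tm
  | app : Val → Val → Tm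
  | choice : Tm → Tm → Tm
  | letin : ℕ → Tm → Tm → Tm
end

-- Substitution of a value for a variable.
mutual
def substV : Val → ℕ → Val → Val
  | .var y, x, V => if y = x then V else .var y
  | .lam y M, x, V => if y = x then .lam y M else .lam y (substT M x V)
def substT : Tm → ℕ → Val → Tm
  | .val W, x, V => .val (substV W x V)
  | .app W U, x, V => .app (substV W x V) (substV U x V)
  | .choice M N, x, V => .choice (substT M x V) (substT N x V)
  | .letin y N M, x, V => .letin y (substT N x V) (if y = x then M else substT M x V)
end

mutual
def fvV : Val → Finset ℕ
  | .var x => {x}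
  | .lam x M => fvT M \ {x}
def fvT : Tm → Finset ℕ
  | .val V => fvV V
  | .app V W => fvV V ∪ fvV W
  | .choice M N => fvT M ∪ fvT N
  | .letin x N M => fvT N ∪ (fvT M \ {x})
end

def Tm.Closed (M : Tm) : Prop := fvT M = ∅
def Val.Closed (V : Val) : Prop := fvV V = ∅

def Tm.isVal : Tm → Bool
  | .val _ => true
  | _ => false

/-! ### Multidistributions and the operational semantics -/

/-- Multidistributions over terms, represented as finite multisets of scaled terms. -/
abbrev MDist := Multiset (ℚ × Tm)

def scaleM (q : ℚ) (m : MDist) : MDist := m.map fun p => (q * p.1, p.2)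

/-- One-step reduction from terms to multidistributions. -/
inductive Step : Tm → MDist → Prop
  | beta (x : ℕ) (M : Tm) (V : Val) :
      Step (.app (.lam x M) V) {(1, substT M x V)}
  | letval (x : ℕ) (V : Val) (M : Tm) :
      Step (.letin x (.val V) M) {(1, substT M x V)}
  | choice (M N : Tm) : Step (.choice M N) {(1/2, M), (1/2, N)}
  | letstep {N : Tm} {m : MDist} (x : ℕ) (M : Tm) :
      Step N m → Step (.letin x N M) (m.map fun p => (p.1, Tm.letin x p.2 M))

/-- Lifting of one-step reduction to multidistributions. -/
inductive Lift : MDist → MDist → Prop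
  | value (V : Val) : Lift {(1, Tm.val V)} {(1, Tm.val V)}
  | single {M : Tm} {m : MDist} : Step M m → Lift {(1, M)} m
  | multi (s : Multiset (ℚ × Tm × MDist)) :
      (∀ x ∈ s, Lift {(1, x.2.1)} x.2.2) →
      Lift (s.map fun x => (x.1, x.2.1)) ((s.map fun x => scaleM x.1 x.2.2).sum)

/-- Functional presentation of one-step reduction (values, and stuck open
terms, are kept unchanged); it agrees with `Step` on closed non-value terms. -/
def stepF : Tm → MDist
  | .val V => {(1, .val V)}
  | .app (.lam x M) W => {(1, substT M x W)}
  | .app (.var y) W => {(1, .app (.var y) W)}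
  | .choice M N => {(1/2, M), (1/2, N)}
  | .letin x (.val V) M => {(1, substT M x V)}
  | .letin x N M => (stepF N).map fun p => (p.1, Tm.letin x p.2 M)

def mstepF (m : MDist) : MDist := (m.map fun p => scaleM p.1 (stepF p.2)).sum

/-- The unique reduction sequence `[M] = 𝔪₀ ⇛ 𝔪₁ ⇛ …` of a closed term. -/
def traj (M : Tm) (k : ℕ) : MDist := mstepF^[k] {(1, M)}

/-- `‖𝔪‖𝒱`: the probability that `𝔪` is a value. -/
def normV (m : MDist) : ℚ := ((m.filter fun p => p.2.isVal = true).map Prod.fst).sum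

/-- `eval_k(M)`: the probability that `M` terminates within `k` steps. -/
def evalP (k : ℕ) (M : Tm) : ℚ := normV (traj M k)

/-- `ProbTerm(M) = sup_k eval_k(M)`. -/
noncomputable def ProbTerm (M : Tm) : ℝ := ⨆ k : ℕ, ((evalP k M : ℚ) : ℝ)

/-- `etime_n(M) = Σ_{k<n} (1 - eval_k(M))`. -/
def etime (n : ℕ) (M : Tm) : ℚ := ∑ k ∈ Finset.range n, (1 - evalP k M)

/-- `ETime(M) = Σ_{k≥0} (1 - eval_k(M)) ∈ [0,∞]`, the expected runtime. -/
noncomputable def ETime (M : Tm) : ℝ≥0∞ :=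
  ∑' k : ℕ, ENNReal.ofReal ((1 : ℝ) - ((evalP k M : ℚ) : ℝ))

/-! ### Non-idempotent monadic intersection types -/

/-- Arrow types `𝖠 ::= 𝒜 → 𝔞`, where `𝒜` is an intersection type
(a finite multiset of scaled arrow types, represented as a list) and `𝔞`
is a type distribution (a multidistribution of intersection types,
represented as a list). -/
inductive ATy : Type
  | arr : List (ℚ × ATy) → List (ℚ × List (ℚ × ATy)) → ATy

/-- Intersection types. -/
abbrev ITy := List (ℚ × ATy)
/-- Type distributions. -/
abbrev DTy := List (ℚ × ITy)

/-- A type of any of the three kinds. -/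
inductive Ty : Type
  | arrow : ATy → Ty
  | inter : ITy → Ty
  | dist : DTy → Ty

/-- Typing contexts. -/
abbrev Ctx := ℕ → ITy

def emptyCtx : Ctx := fun _ => []

def scaleL {α : Type} (q : ℚ) (l : List (ℚ × α)) : List (ℚ × α) :=
  l.map fun p => (q * p.1, p.2)

def ctxUnion (Γ Δ : Ctx) : Ctx := fun x => Γ x ++ Δ x

/-- A type distribution is tight if every intersection type in it is empty. -/
def Tight (a : DTy) : Prop := ∀ p ∈ a, p.2 = ([] : ITy)

/-- `‖𝔞‖`: the sum of the probabilities occurring in a type distribution. -/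
def normD (a : DTy) : ℚ := (a.map Prod.fst).sum

/-- Typing derivations `Π ⊳ Γ ⊢_w M : σ`. -/
inductive Deriv : Ctx → ℚ → Tm → Ty → Type
  | var (x : ℕ) (A : ITy) :
      Deriv (Function.update emptyCtx x A) 0 (.val (.var x)) (.inter A)
  | zero (M : Tm) : Deriv emptyCtx 0 M (.dist [])
  | lam {Γ : Ctx} {w : ℚ} {M : Tm} (x : ℕ) (b : DTy) :
      Deriv Γ w M (.dist b) →
      Deriv (Function.update Γ x []) (w + 1) (.val (.lam x M)) (.arrow (.arr (Γ x) b))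
  | app {Γ Δ : Ctx} {w v : ℚ} {V W : Val} {A : ITy} {b : DTy} :
      Deriv Γ w (.val V) (.inter [(1, .arr A b)]) →
      Deriv Δ v (.val W) (.inter A) →
      Deriv (ctxUnion Γ Δ) (w + v) (.app V W) (.dist b)
  | choice {Γ Δ : Ctx} {w v : ℚ} {M N : Tm} {a b : DTy} :
      Deriv Γ w M (.dist a) → Deriv Δ v N (.dist b) →
      Deriv (ctxUnion (fun y => scaleL (1/2) (Γ y)) (fun y => scaleL (1/2) (Δ y)))
        (w / 2 + v / 2 + 1) (.choice M N)
        (.dist (scaleL (1/2) a ++ scaleL (1/2) b))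
  | letin {Γ : Ctx} {v : ℚ} (x : ℕ) {N M : Tm}
      (K : List (ℚ × ITy × Ctx × ℚ × DTy)) :
      (∀ k ∈ K, k.2.2.1 x = []) →
      ((i : Fin K.length) →
        Deriv (Function.update (K.get i).2.2.1 x (K.get i).2.1)
          (K.get i).2.2.2.1 M (.dist (K.get i).2.2.2.2)) →
      Deriv Γ v N (.dist (K.map fun k => (k.1, k.2.1))) →
      Deriv (ctxUnion Γ (fun y => (K.map fun k => scaleL k.1 (k.2.2.1 y)).flatten))
        ((K.map fun k => k.1 * k.2.2.2.1).sum + v + 1)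
        (.letin x N M)
        (.dist (K.map fun k => scaleL k.1 k.2.2.2.2).flatten)
  | tval {Γ : Ctx} {w : ℚ} {V : Val} {A : ITy} :
      Deriv Γ w (.val V) (.inter A) → Deriv Γ w (.val V) (.dist [(1, A)])
  | bang {V : Val} (I : List (ℚ × Ctx × ℚ × ATy)) :
      (∀ k ∈ I, 0 < k.1 ∧ k.1 ≤ 1) →
      ((i : Fin I.length) →
        Deriv (I.get i).2.1 (I.get i).2.2.1 (.val V) (.arrow (I.get i).2.2.2)) →
      Deriv (fun y => (I.map fun k => scaleL k.1 (k.2.1 y)).flatten)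
        ((I.map fun k => k.1 * k.2.2.1).sum) (.val V)
        (.inter (I.map fun k => (k.1, k.2.2.2)))

/-- Size of a derivation: the number of rules, excluding `!` and `Val`. -/
def Deriv.size : ∀ {Γ : Ctx} {w : ℚ} {M : Tm} {τ : Ty}, Deriv Γ w M τ → ℕ
  | _, _, _, _, .var _ _ => 1
  | _, _, _, _, .zero _ => 1
  | _, _, _, _, .lam _ _ d => d.size + 1
  | _, _, _, _, .app d e => d.size + e.size + 1
  | _, _, _, _, .choice d e => d.size + e.size + 1
  | _, _, _, _, .letin _ _ _ f d => d.size + (List.ofFn fun i => (f i).size).sum + 1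
  | _, _, _, _, .tval d => d.size
  | _, _, _, _, .bang _ _ f => (List.ofFn fun i => (f i).size).sum


/-! ### Auxiliary size-indexed system -/

/-- Judgement kinds of the auxiliary system; `fam` types the body of a `let`. -/
inductive Jt : Type
  | arrow : ATy → Jt
  | inter : ITy → Jt
  | dist : DTy → Jt
  | fam : ℕ → DTy → DTy → Jt

inductive D (S : ℚ → Prop) : ℕ → Ctx → ℚ → Tm → Jt → Prop
  | var {N Γ w} (x : ℕ) (A : ITy) (hΓ : Γ = Function.update emptyCtx x A) (hw : w = 0) :
      D S N Γ w (.val (.var x)) (.inter A)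
  | zero {N Γ w} (M : Tm) (hΓ : Γ = emptyCtx) (hw : w = 0) : D S N Γ w M (.dist [])
  | lam {N Γ w n Γ' w' M A b} (x : ℕ) (hd : D S n Γ' w' M (.dist b))
      (hn : n + 1 ≤ N) (hΓ : Γ = Function.update Γ' x []) (hw : w = w' + 1) (hA : A = Γ' x) :
      D S N Γ w (.val (.lam x M)) (.arrow (.arr A b))
  | app {N Γ w n m Γ₁ Γ₂ w₁ w₂ V W A b} (h₁ : D S n Γ₁ w₁ (.val V) (.inter [(1, .arr A b)]))
      (h₂ : D S m Γ₂ w₂ (.val W) (.inter A))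
      (hn : n + m ≤ N) (hΓ : Γ = ctxUnion Γ₁ Γ₂) (hw : w = w₁ + w₂) :
      D S N Γ w (.app V W) (.dist b)
  | choice {N Γ w c n m Γ₁ Γ₂ w₁ w₂ M₁ M₂ a b} (h₁ : D S n Γ₁ w₁ M₁ (.dist a))
      (h₂ : D S m Γ₂ w₂ M₂ (.dist b))
      (hn : n + m + 1 ≤ N)
      (hΓ : Γ = ctxUnion (fun y => scaleL (1/2) (Γ₁ y)) (fun y => scaleL (1/2) (Γ₂ y)))
      (hw : w = w₁ / 2 + w₂ / 2 + 1) (hc : c = scaleL (1/2) a ++ scaleL (1/2) b) :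
      D S N Γ w (.choice M₁ M₂) (.dist c)
  | letin {N Γ w n m Γ₁ Γ₂ w₁ w₂ P M K b} (x : ℕ) (h₁ : D S n Γ₁ w₁ P (.dist K))
      (h₂ : D S m Γ₂ w₂ M (.fam x K b))
      (hn : n + m + 1 ≤ N) (hΓ : Γ = ctxUnion Γ₁ Γ₂) (hw : w = w₂ + w₁ + 1) :
      D S N Γ w (.letin x P M) (.dist b)
  | tval {N Γ w V A} (h : D S N Γ w (.val V) (.inter A)) :
      D S N Γ w (.val V) (.dist [(1, A)])
  | bnil {N Γ w} (y : ℕ) (M : Tm) (hΓ : Γ = emptyCtx) (hw : w = 0) :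
      D S N Γ w (.val (.lam y M)) (.inter [])
  | bcons {N Γ w n m Γ₁ Γ₂ w₁ w₂ y M T A} (q : ℚ) (hq : S q)
      (h₁ : D S n Γ₁ w₁ (.val (.lam y M)) (.arrow T))
      (h₂ : D S m Γ₂ w₂ (.val (.lam y M)) (.inter A))
      (hn : n + m ≤ N) (hΓ : Γ = ctxUnion (fun z => scaleL q (Γ₁ z)) Γ₂) (hw : w = q * w₁ + w₂) :
      D S N Γ w (.val (.lam y M)) (.inter ((q, T) :: A))
  | fnil {N Γ w} (x : ℕ) (M : Tm) (hΓ : Γ = emptyCtx) (hw : w = 0) :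
      D S N Γ w M (.fam x [] [])
  | fcons {N Γ w d n m Γ₁ Γ₂ w₁ w₂ x M b K c A} (p : ℚ) (hp : S p)
      (h₁ : D S n Γ₁ w₁ M (.dist b)) (h₂ : D S m Γ₂ w₂ M (.fam x K c))
      (hn : n + m ≤ N)
      (hΓ : Γ = ctxUnion (fun z => scaleL p (Function.update Γ₁ x [] z)) Γ₂)
      (hw : w = p * w₁ + w₂) (hA : A = Γ₁ x) (hd : d = scaleL p b ++ c) :
      D S N Γ w M (.fam x ((p, A) :: K) d)

section Aux

variable {S : ℚ → Prop}

theorem D.mono {n n' Γ w M τ} (h : D S n Γ w M τ) (hn : n ≤ n') : D S n' Γ w M τ := by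
  induction h generalizing n' with
  | var x A hΓ hw => exact .var x A hΓ hw
  | zero M hΓ hw => exact .zero M hΓ hw
  | lam x hd h1 hΓ hw hA _ => exact .lam x hd (by omega) hΓ hw hA
  | app h₁ h₂ h1 hΓ hw _ _ => exact .app h₁ h₂ (by omega) hΓ hw
  | choice h₁ h₂ h1 hΓ hw hc _ _ => exact .choice h₁ h₂ (by omega) hΓ hw hc
  | letin x h₁ h₂ h1 hΓ hw _ _ => exact .letin x h₁ h₂ (by omega) hΓ hw
  | tval h ih => exact .tval (ih hn)
  | bnil y M hΓ hw => exact .bnil y M hΓ hw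
  | bcons q hq h₁ h₂ h1 hΓ hw _ _ => exact .bcons q hq h₁ h₂ (by omega) hΓ hw
  | fnil x M hΓ hw => exact .fnil x M hΓ hw
  | fcons p hp h₁ h₂ h1 hΓ hw hA hd _ _ => exact .fcons p hp h₁ h₂ (by omega) hΓ hw hA hd

@[simp] theorem scaleL_nil {α : Type} (q : ℚ) : scaleL q ([] : List (ℚ × α)) = [] := rfl
@[simp] theorem scaleL_cons {α : Type} (q : ℚ) (a : ℚ × α) (l) :
    scaleL q (a :: l) = (q * a.1, a.2) :: scaleL q l := rfl
@[simp] theorem scaleL_append {α : Type} (q : ℚ) (l l' : List (ℚ × α)) :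
    scaleL q (l ++ l') = scaleL q l ++ scaleL q l' := by simp [scaleL]
@[simp] theorem scaleL_one {α : Type} (l : List (ℚ × α)) : scaleL 1 l = l := by
  simp [scaleL]
theorem scaleL_scaleL {α : Type} (p q : ℚ) (l : List (ℚ × α)) :
    scaleL p (scaleL q l) = scaleL (p * q) l := by
  simp [scaleL, mul_assoc]
@[simp] theorem scaleL_eq_nil {α : Type} (q : ℚ) (l : List (ℚ × α)) :
    scaleL q l = [] ↔ l = [] := by simp [scaleL]
@[simp] theorem emptyCtx_apply (z : ℕ) : emptyCtx z = [] := rfl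
@[simp] theorem update_emptyCtx (z : ℕ) : Function.update emptyCtx z [] = emptyCtx := by
  funext y; simp [Function.update_apply]
@[simp] theorem ctxUnion_apply (Γ Δ : Ctx) (z : ℕ) : ctxUnion Γ Δ z = Γ z ++ Δ z := rfl

theorem ctxUnion_eq_empty {Γ Δ : Ctx} (h : emptyCtx = ctxUnion Γ Δ) :
    Γ = emptyCtx ∧ Δ = emptyCtx := by
  constructor <;> funext y <;> have := congrFun h y <;> simp at this <;> simp [this]

theorem scaleCtx_eq_empty {q : ℚ} {Γ : Ctx} (h : (fun z => scaleL q (Γ z)) = emptyCtx) :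
    Γ = emptyCtx := by
  funext y; have := congrFun h y; simpa using this

@[simp] theorem ctxUnion_empty : ctxUnion emptyCtx emptyCtx = emptyCtx := rfl
theorem scaleCtx_empty (q : ℚ) : (fun z => scaleL q (emptyCtx z)) = emptyCtx := rfl

/-- Relevance -/
theorem D.relevant {n Γ w M τ} (h : D S n Γ w M τ) :
    ∀ z, (z ∉ fvT M ∨ ∃ K b, τ = .fam z K b) → Γ z = [] := by
  induction h with
  | var x A hΓ hw => 
      intro z hz; simp [fvT, fvV] at hz; subst hΓ; simp [Function.update_of_ne hz]
  | zero M hΓ hw => intro z hz; subst hΓ; rfl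
  | lam x hd h1 hΓ hw hA ih =>
      intro z hz; subst hΓ; simp [fvT, fvV] at hz
      by_cases hzx : z = x
      · subst hzx; simp
      · rw [Function.update_of_ne hzx]; exact ih z (Or.inl fun h => hzx (hz h))
  | app h₁ h₂ h1 hΓ hw ih1 ih2 =>
      intro z hz; subst hΓ; simp [fvT] at hz
      simp [ih1 z (Or.inl (by simpa [fvT] using hz.1)), ih2 z (Or.inl (by simpa [fvT] using hz.2))]
  | choice h₁ h₂ h1 hΓ hw hc ih1 ih2 =>
      intro z hz; subst hΓ; simp [fvT] at hz
      simp [ih1 z (Or.inl (by simpa [fvT] using hz.1)), ih2 z (Or.inl (by simpa [fvT] using hz.2))]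
  | @letin N Γ w n m Γ₁ Γ₂ w₁ w₂ P M K b x h₁ h₂ h1 hΓ hw ih1 ih2 =>
      intro z hz; subst hΓ; simp [fvT] at hz
      have : Γ₂ z = [] := by
        by_cases hzx : z = x
        · subst hzx; exact ih2 z (Or.inr ⟨_, _, rfl⟩)
        · exact ih2 z (Or.inl fun h => hzx (hz.2 h))
      simp [ih1 z (Or.inl hz.1), this]
  | tval h ih => intro z hz; exact ih z (Or.inl (by simpa using hz))
  | bnil y M hΓ hw => intro z hz; subst hΓ; rfl
  | @bcons N Γ w n m Γ₁ Γ₂ w₁ w₂ y M T A q hq h₁ h₂ h1 hΓ hw ih1 ih2 =>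
      intro z hz; subst hΓ
      have hz' : z ∉ fvT (.val (.lam y M)) := by simpa using hz
      simp [ih1 z (Or.inl hz'), ih2 z (Or.inl hz')]
  | fnil x M hΓ hw => intro z hz; subst hΓ; rfl
  | @fcons N Γ w d n m Γ₁ Γ₂ w₁ w₂ x M b K c A p hp h₁ h₂ h1 hΓ hw hA hd ih1 ih2 =>
      intro z hz; subst hΓ
      by_cases hzx : z = x
      · subst hzx; simp [ih2 z (Or.inr ⟨_, _, rfl⟩)]
      · have hz' : z ∉ fvT M := by
          rcases hz with hz | ⟨K, b, h⟩
          · exact hz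
          · cases h; exact absurd rfl hzx
        simp [ih1 z (Or.inl hz'), ih2 z (Or.inl hz'), Function.update_of_ne hzx]

theorem D.closed {n Γ w M τ} (h : D S n Γ w M τ) (hM : fvT M = ∅) : Γ = emptyCtx := by
  funext z; exact h.relevant z (Or.inl (by simp [hM]))

theorem D.fam_ctx {n Γ w M x K b} (h : D S n Γ w M (.fam x K b)) : Γ x = [] :=
  h.relevant x (Or.inr ⟨_, _, rfl⟩)

/-! Intersection splitting for closed-context abstractions -/

theorem D.inter_nil {n w y M} (h : D S n emptyCtx w (.val (.lam y M)) (.inter [])) : w = 0 := by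
  cases h; assumption

theorem D.inter_cons {n w y M q T A}
    (h : D S n emptyCtx w (.val (.lam y M)) (.inter ((q, T) :: A))) :
    S q ∧ ∃ n₁ n₂ w₁ w₂, D S n₁ emptyCtx w₁ (.val (.lam y M)) (.arrow T) ∧
      D S n₂ emptyCtx w₂ (.val (.lam y M)) (.inter A) ∧ n₁ + n₂ ≤ n ∧ w = q * w₁ + w₂ := by
  cases h with
  | bcons q hq h₁ h₂ h1 hΓ hw =>
    obtain ⟨ha, hb⟩ := ctxUnion_eq_empty hΓ
    have ha := scaleCtx_eq_empty ha
    subst ha; subst hb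
    exact ⟨hq, _, _, _, _, h₁, h₂, h1, hw⟩

theorem D.inter_mk {n₁ n₂ w₁ w₂ y M q T A} (hq : S q)
    (h₁ : D S n₁ emptyCtx w₁ (.val (.lam y M)) (.arrow T))
    (h₂ : D S n₂ emptyCtx w₂ (.val (.lam y M)) (.inter A)) :
    D S (n₁ + n₂) emptyCtx (q * w₁ + w₂) (.val (.lam y M)) (.inter ((q, T) :: A)) :=
  .bcons q hq h₁ h₂ le_rfl rfl rfl

theorem D.inter_split {y M} {A B : ITy} {n w}
    (h : D S n emptyCtx w (.val (.lam y M)) (.inter (A ++ B))) :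
    ∃ n₁ n₂ w₁ w₂, D S n₁ emptyCtx w₁ (.val (.lam y M)) (.inter A) ∧
      D S n₂ emptyCtx w₂ (.val (.lam y M)) (.inter B) ∧ n₁ + n₂ ≤ n ∧ w = w₁ + w₂ := by
  induction A generalizing n w with
  | nil => exact ⟨0, n, 0, w, .bnil _ _ rfl rfl, h, by simp, by simp⟩
  | cons a A ih =>
    obtain ⟨q, T⟩ := a
    obtain ⟨hq, n₁, n₂, w₁, w₂, h₁, h₂, hn, hw⟩ := D.inter_cons h
    obtain ⟨m₁, m₂, v₁, v₂, k₁, k₂, hm, hv⟩ := ih h₂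
    exact ⟨_, _, _, _, D.inter_mk hq h₁ k₁, k₂, by omega, by rw [hw, hv]; ring⟩

theorem D.inter_append {y M} {A B : ITy} {n w n' w'}
    (h : D S n emptyCtx w (.val (.lam y M)) (.inter A))
    (h' : D S n' emptyCtx w' (.val (.lam y M)) (.inter B)) :
    ∃ m, D S m emptyCtx (w + w') (.val (.lam y M)) (.inter (A ++ B)) := by
  induction A generalizing n w with
  | nil => rw [h.inter_nil]; exact ⟨n', by simpa using h'⟩
  | cons a A ih =>
    obtain ⟨q, T⟩ := a
    obtain ⟨hq, n₁, n₂, w₁, w₂, h₁, h₂, hn, hw⟩ := D.inter_cons h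
    obtain ⟨m, hm⟩ := ih h₂
    have := D.inter_mk hq h₁ hm
    exact ⟨_, by rw [hw, add_assoc]; exact this⟩

theorem D.inter_scale {y M} {A : ITy} {n w p} (hp : ∀ q, S q → S (p * q))
    (h : D S n emptyCtx w (.val (.lam y M)) (.inter A)) :
    ∃ m, D S m emptyCtx (p * w) (.val (.lam y M)) (.inter (scaleL p A)) := by
  induction A generalizing n w with
  | nil => rw [h.inter_nil]; exact ⟨0, .bnil _ _ rfl (by simp)⟩
  | cons a A ih =>
    obtain ⟨q, T⟩ := a
    obtain ⟨hq, n₁, n₂, w₁, w₂, h₁, h₂, hn, hw⟩ := D.inter_cons h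
    obtain ⟨m, hm⟩ := ih h₂
    have := D.inter_mk (hp _ hq) h₁ hm
    exact ⟨_, by rw [hw, mul_add, ← mul_assoc]; exact this⟩

theorem D.inter_unscale {y M} {A : ITy} {n w p} (hS : ∀ q, S q)
    (h : D S n emptyCtx w (.val (.lam y M)) (.inter (scaleL p A))) :
    ∃ v, D S n emptyCtx v (.val (.lam y M)) (.inter A) ∧ w = p * v := by
  induction A generalizing n w with
  | nil => exact ⟨0, .bnil _ _ rfl rfl, by simpa using h.inter_nil⟩
  | cons a A ih =>
    obtain ⟨q, T⟩ := a
    obtain ⟨hq, n₁, n₂, w₁, w₂, h₁, h₂, hn, hw⟩ := D.inter_cons h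
    obtain ⟨v, hv, hv'⟩ := ih h₂
    exact ⟨_, (D.inter_mk (hS q) h₁ hv).mono hn, by rw [hw, hv']; ring⟩

theorem D.subst {n Γ w M τ} (hS : ∀ q, S q) (h : D S n Γ w M τ) {x y : ℕ} {P : Tm} :
    (∀ z K b, τ = .fam z K b → z ≠ x) → ∀ m v,
    D S m emptyCtx v (.val (.lam y P)) (.inter (Γ x)) →
    D S (n + m) (Function.update Γ x []) (w + v) (substT M x (.lam y P)) τ := by
  induction h with
  | var z A hΓ hw =>
      intro _ m v hv; subst hΓ; subst hw
      by_cases hz : z = x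
      · subst hz
        simp only [Function.update_self] at hv
        simp only [substT, substV, if_true, Function.update_idem, update_emptyCtx, zero_add]
        exact hv.mono (by omega)
      · rw [Function.update_of_ne (Ne.symm hz)] at hv
        rw [hv.inter_nil]
        simp only [substT, substV, hz, if_false]
        refine .var z A ?_ (by simp)
        funext u; simp only [Function.update_apply, emptyCtx_apply]; split_ifs <;> simp_all
  | zero M hΓ hw =>
      intro _ m v hv; subst hΓ; subst hw
      rw [hv.inter_nil]
      exact .zero _ (by simp) (by simp)
  | @lam N Γ w n Γ' w' M A b z hd hn hΓ hw hA ih =>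
      intro _ m v hv; subst hΓ
      by_cases hz : z = x
      · subst hz
        simp only [Function.update_self] at hv
        rw [hv.inter_nil]
        simp only [substT, substV, if_true]
        exact .lam z hd (by omega) (by simp) (by simp [hw]) hA
      · rw [Function.update_of_ne (Ne.symm hz)] at hv
        simp only [substT, substV, hz, if_false]
        refine .lam z (ih (by simp) m v hv) (by omega) ?_ (by rw [hw]; ring) ?_
        · rw [Function.update_comm hz]
        · rw [Function.update_of_ne hz]; exact hA
  | app h₁ h₂ hn hΓ hw ih1 ih2 =>
      intro _ m v hv; subst hΓ
      obtain ⟨m₁, m₂, v₁, v₂, k₁, k₂, hm, hv'⟩ := D.inter_split hv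
      simp only [substT]
      refine .app (ih1 (by simp) m₁ v₁ k₁) (ih2 (by simp) m₂ v₂ k₂) (by omega) ?_
        (by rw [hw, hv']; ring)
      funext u; simp only [Function.update_apply, ctxUnion_apply]; split_ifs <;> simp_all
  | choice h₁ h₂ hn hΓ hw hc ih1 ih2 =>
      intro _ m v hv; subst hΓ
      obtain ⟨m₁, m₂, v₁, v₂, k₁, k₂, hm, hv'⟩ := D.inter_split hv
      obtain ⟨u₁, j₁, e₁⟩ := D.inter_unscale hS k₁
      obtain ⟨u₂, j₂, e₂⟩ := D.inter_unscale hS k₂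
      simp only [substT]
      refine .choice (ih1 (by simp) m₁ u₁ j₁) (ih2 (by simp) m₂ u₂ j₂) (by omega) ?_
        (by rw [hw, hv', e₁, e₂]; ring) hc
      funext u; simp only [Function.update_apply, ctxUnion_apply]; split_ifs <;> simp_all
  | @letin N Γ w n m' Γ₁ Γ₂ w₁ w₂ Q M K b z h₁ h₂ hn hΓ hw ih1 ih2 =>
      intro _ m v hv; subst hΓ
      simp only [substT]
      by_cases hz : z = x
      · subst hz
        have h0 := h₂.fam_ctx
        rw [ctxUnion_apply, h0, List.append_nil] at hv
        rw [if_pos rfl]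
        refine .letin z (ih1 (by simp) m v hv) h₂ (by omega) ?_ (by rw [hw]; ring)
        funext u; simp only [Function.update_apply, ctxUnion_apply]; split_ifs <;> simp_all
      · obtain ⟨m₁, m₂, v₁, v₂, k₁, k₂, hm, hv'⟩ := D.inter_split hv
        rw [if_neg hz]
        refine .letin z (ih1 (by simp) m₁ v₁ k₁)
          (ih2 (by intro _ _ _ h; cases h; exact hz) m₂ v₂ k₂) (by omega) ?_
          (by rw [hw, hv']; ring)
        funext u; simp only [Function.update_apply, ctxUnion_apply]; split_ifs <;> simp_all
  | tval h ih =>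
      intro _ m v hv
      have := ih (by simp) m v hv
      simp only [substT] at this ⊢
      exact .tval this
  | bnil z M hΓ hw =>
      intro _ m v hv; subst hΓ; subst hw
      rw [hv.inter_nil]
      have : ∃ M', substV (.lam z M) x (.lam y P) = .lam z M' := by
        simp only [substV]; split_ifs <;> exact ⟨_, rfl⟩
      obtain ⟨M', e⟩ := this
      simp only [substT, e]
      exact .bnil _ _ (by simp) (by simp)
  | @bcons N Γ w n m' Γ₁ Γ₂ w₁ w₂ z M T A q hq h₁ h₂ hn hΓ hw ih1 ih2 =>
      intro _ m v hv; subst hΓ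
      obtain ⟨m₁, m₂, v₁, v₂, k₁, k₂, hm, hv'⟩ := D.inter_split hv
      obtain ⟨u₁, j₁, e₁⟩ := D.inter_unscale hS k₁
      have : ∃ M', substV (.lam z M) x (.lam y P) = .lam z M' := by
        simp only [substV]; split_ifs <;> exact ⟨_, rfl⟩
      obtain ⟨M', e⟩ := this
      have i1 := ih1 (by simp) m₁ u₁ j₁
      have i2 := ih2 (by simp) m₂ v₂ k₂
      simp only [substT, e] at i1 i2 ⊢
      refine .bcons q hq i1 i2 (by omega) ?_ (by rw [hw, hv', e₁]; ring)
      funext u; simp only [Function.update_apply, ctxUnion_apply]; split_ifs <;> simp_all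
  | fnil z M hΓ hw =>
      intro _ m v hv; subst hΓ; subst hw
      rw [hv.inter_nil]
      exact .fnil _ _ (by simp) (by simp)
  | @fcons N Γ w d n m' Γ₁ Γ₂ w₁ w₂ z M b K c A p hp h₁ h₂ hn hΓ hw hA hd ih1 ih2 =>
      intro hf m v hv; subst hΓ
      have hz : z ≠ x := hf _ _ _ rfl
      obtain ⟨m₁, m₂, v₁, v₂, k₁, k₂, hm, hv'⟩ := D.inter_split hv
      simp only [Function.update_of_ne hz.symm] at k₁
      obtain ⟨u₁, j₁, e₁⟩ := D.inter_unscale hS k₁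
      refine .fcons p hp (ih1 (by simp) m₁ u₁ j₁)
        (ih2 (by intro _ _ _ h; cases h; exact hz) m₂ v₂ k₂) (by omega) ?_
        (by rw [hw, hv', e₁]; ring) (by rw [Function.update_of_ne hz]; exact hA) hd
      funext u; simp only [Function.update_apply, ctxUnion_apply]; split_ifs <;> simp_all

theorem D.antisubst {n Γ w N τ} (hhalf : S (1/2)) (hmul : ∀ p q, S p → S q → S (p * q))
    (h : D S n Γ w N τ) {x y : ℕ} {P : Tm} (hcl : fvV (.lam y P) = ∅) :
    ∀ M, N = substT M x (.lam y P) → (∀ T, τ = .arrow T → M ≠ .val (.var x)) →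
    (∀ z K b, τ = .fam z K b → z ≠ x) →
    ∃ A n₁ w₁ m v, D S n₁ (Function.update Γ x A) w₁ M τ ∧
      D S m emptyCtx v (.val (.lam y P)) (.inter A) ∧ w = w₁ + v := by
  induction h with
  | var z A hΓ hw =>
      intro M hM _ _; subst hΓ; subst hw
      cases M with
      | val W =>
        cases W with
        | var u =>
          simp only [substT, substV] at hM
          split_ifs at hM with hu
          cases hM
          refine ⟨[], 0, 0, 0, 0, .var _ A ?_ rfl, .bnil _ _ rfl rfl, by simp⟩
          funext u; simp only [Function.update_apply, emptyCtx_apply]; split_ifs <;> simp_all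
        | lam u M' =>
          simp only [substT, substV] at hM
          split_ifs at hM <;> cases hM
      | _ => simp [substT] at hM
  | zero M hΓ hw =>
      intro M hM _ _; subst hΓ; subst hw
      exact ⟨[], 0, 0, 0, 0, .zero _ (by simp) rfl, .bnil _ _ rfl rfl, by simp⟩
  | @lam N Γ w n Γ' w' M A b z hd hn hΓ hw hA ih =>
      intro M₀ hM hv _; subst hΓ
      cases M₀ with
      | val W =>
        cases W with
        | var u =>
          simp only [substT, substV] at hM
          split_ifs at hM with hu
          · subst hu; exact absurd rfl (hv _ rfl)
          · cases hM
        | lam u M' =>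
          simp only [substT, substV] at hM
          split_ifs at hM with hu
          · cases hM; subst hu
            exact ⟨[], _, w, 0, 0, .lam z hd hn (by simp) hw hA, .bnil _ _ rfl rfl, by simp⟩
          · cases hM
            obtain ⟨B, n₁, w₁, m, v, k₁, k₂, e⟩ := ih M' rfl (by simp) (by simp)
            refine ⟨B, _, w₁ + 1, m, v, .lam z k₁ le_rfl ?_ rfl ?_, k₂, by rw [hw, e]; ring⟩
            · rw [Function.update_comm hu]
            · rw [Function.update_of_ne hu]; exact hA
      | _ => simp [substT] at hM
  | app h₁ h₂ hn hΓ hw ih1 ih2 =>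
      intro M₀ hM hv _; subst hΓ
      cases M₀ with
      | app V₁ V₂ =>
        simp only [substT, Tm.app.injEq] at hM
        obtain ⟨A₁, n₁, w₁, m₁, v₁, a₁, b₁, e₁⟩ :=
          ih1 (.val V₁) (by simp [substT, hM.1]) (by simp) (by simp)
        obtain ⟨A₂, n₂, w₂, m₂, v₂, a₂, b₂, e₂⟩ :=
          ih2 (.val V₂) (by simp [substT, hM.2]) (by simp) (by simp)
        obtain ⟨m, hm⟩ := b₁.inter_append b₂
        refine ⟨A₁ ++ A₂, _, _, m, _, .app a₁ a₂ le_rfl ?_ rfl, hm, by rw [hw, e₁, e₂]; ring⟩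
        funext u; simp only [Function.update_apply, ctxUnion_apply]; split_ifs <;> simp_all
      | _ => simp [substT] at hM
  | choice h₁ h₂ hn hΓ hw hc ih1 ih2 =>
      intro M₀ hM hv _; subst hΓ
      cases M₀ with
      | choice V₁ V₂ =>
        simp only [substT, Tm.choice.injEq] at hM
        obtain ⟨A₁, n₁, w₁, m₁, v₁, a₁, b₁, e₁⟩ := ih1 V₁ hM.1 (by simp) (by simp)
        obtain ⟨A₂, n₂, w₂, m₂, v₂, a₂, b₂, e₂⟩ := ih2 V₂ hM.2 (by simp) (by simp)
        obtain ⟨_, b₁⟩ := b₁.inter_scale (p := 1/2) (fun q => hmul _ q hhalf)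
        obtain ⟨_, b₂⟩ := b₂.inter_scale (p := 1/2) (fun q => hmul _ q hhalf)
        obtain ⟨m, hm⟩ := b₁.inter_append b₂
        refine ⟨scaleL (1/2) A₁ ++ scaleL (1/2) A₂, _, _, m, _, .choice a₁ a₂ le_rfl ?_ rfl hc, hm,
          by rw [hw, e₁, e₂]; ring⟩
        funext u; simp only [Function.update_apply, ctxUnion_apply]; split_ifs <;> simp_all
      | _ => simp [substT] at hM
  | @letin N Γ w n m' Γ₁ Γ₂ w₁ w₂ Q M K b z h₁ h₂ hn hΓ hw ih1 ih2 =>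
      intro M₀ hM hv _; subst hΓ
      cases M₀ with
      | letin u V₁ V₂ =>
        simp only [substT, Tm.letin.injEq] at hM
        obtain ⟨rfl, hM1, hM2⟩ := hM
        obtain ⟨A₁, n₁, w₁, m₁, v₁, a₁, b₁, e₁⟩ := ih1 V₁ hM1 (by simp) (by simp)
        split_ifs at hM2 with hz
        · subst hM2; subst hz
          have h0 := h₂.fam_ctx
          refine ⟨A₁, _, _, _, _, .letin z a₁ h₂ le_rfl ?_ rfl, b₁, by rw [hw, e₁]; ring⟩
          funext u; simp only [Function.update_apply, ctxUnion_apply]; split_ifs <;> simp_all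
        · obtain ⟨A₂, n₂, w₂, m₂, v₂, a₂, b₂, e₂⟩ :=
            ih2 V₂ hM2 (by simp) (by intro _ _ _ h; cases h; exact hz)
          obtain ⟨m, hm⟩ := b₁.inter_append b₂
          refine ⟨A₁ ++ A₂, _, _, m, _, .letin z a₁ a₂ le_rfl ?_ rfl, hm,
            by rw [hw, e₁, e₂]; ring⟩
          funext u; simp only [Function.update_apply, ctxUnion_apply]; split_ifs <;> simp_all
      | _ => simp [substT] at hM
  | tval h ih =>
      intro M₀ hM _ _
      obtain ⟨A₁, n₁, w₁, m₁, v₁, a₁, b₁, e₁⟩ := ih M₀ hM (by simp) (by simp)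
      cases M₀ with
      | val W => exact ⟨A₁, n₁, w₁, m₁, v₁, .tval a₁, b₁, e₁⟩
      | _ => simp [substT] at hM
  | bnil z M hΓ hw =>
      intro M₀ hM _ _; subst hΓ; subst hw
      cases M₀ with
      | val W =>
        cases W with
        | var u =>
          simp only [substT, substV] at hM
          split_ifs at hM with hu
          · subst hu
            exact ⟨[], 0, 0, 0, 0, .var u [] rfl rfl, .bnil _ _ rfl rfl, by simp⟩
          · cases hM
        | lam u M' =>
          exact ⟨[], 0, 0, 0, 0, .bnil _ _ (by simp) rfl, .bnil _ _ rfl rfl, by simp⟩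
      | _ => simp [substT] at hM
  | @bcons N Γ w n m' Γ₁ Γ₂ w₁ w₂ z M T A q hq h₁ h₂ hn hΓ hw ih1 ih2 =>
      intro M₀ hM _ _
      cases M₀ with
      | val W =>
        cases W with
        | var u =>
          simp only [substT, substV] at hM
          split_ifs at hM with hu
          · subst hu
            have hd := D.bcons q hq h₁ h₂ hn hΓ hw
            rw [hM] at hd
            have h0 := hd.closed (by simpa [fvT] using hcl)
            rw [h0] at hd
            exact ⟨_, 0, 0, _, w, .var u _ (by rw [h0]) rfl, hd, by simp⟩
          · cases hM
        | lam u M' =>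
          subst hΓ
          obtain ⟨A₁, n₁, w₁, m₁, v₁, a₁, b₁, e₁⟩ := ih1 _ hM (by simp) (by simp)
          obtain ⟨A₂, n₂, w₂, m₂, v₂, a₂, b₂, e₂⟩ := ih2 _ hM (by simp) (by simp)
          obtain ⟨_, b₁⟩ := b₁.inter_scale (p := q) (fun r => hmul _ r hq)
          obtain ⟨m, hm⟩ := b₁.inter_append b₂
          refine ⟨scaleL q A₁ ++ A₂, _, _, m, _, .bcons q hq a₁ a₂ le_rfl ?_ rfl, hm,
            by rw [hw, e₁, e₂]; ring⟩
          funext u; simp only [Function.update_apply, ctxUnion_apply]; split_ifs <;> simp_all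
      | _ => simp [substT] at hM
  | fnil z M hΓ hw =>
      intro M₀ hM _ _; subst hΓ; subst hw
      exact ⟨[], 0, 0, 0, 0, .fnil _ _ (by simp) rfl, .bnil _ _ rfl rfl, by simp⟩
  | @fcons N Γ w d n m' Γ₁ Γ₂ w₁ w₂ z M b K c A p hp h₁ h₂ hn hΓ hw hA hd ih1 ih2 =>
      intro M₀ hM _ hf; subst hΓ
      have hz : z ≠ x := hf _ _ _ rfl
      obtain ⟨A₁, n₁, w₁, m₁, v₁, a₁, b₁, e₁⟩ := ih1 _ hM (by simp) (by simp)
      obtain ⟨A₂, n₂, w₂, m₂, v₂, a₂, b₂, e₂⟩ := ih2 _ hM (by simp)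
        (by intro _ _ _ h; cases h; exact hz)
      obtain ⟨_, b₁⟩ := b₁.inter_scale (p := p) (fun r => hmul _ r hp)
      obtain ⟨m, hm⟩ := b₁.inter_append b₂
      refine ⟨scaleL p A₁ ++ A₂, _, _, m, _, .fcons p hp a₁ a₂ le_rfl ?_ rfl
        (by rw [Function.update_of_ne hz]; exact hA) hd, hm,
        by rw [hw, e₁, e₂]; ring⟩
      funext u; simp only [Function.update_apply, ctxUnion_apply]; split_ifs <;> simp_all

/-! Families over the empty context -/

theorem D.fam_nil {n w M x b} (h : D S n emptyCtx w M (.fam x [] b)) : b = [] ∧ w = 0 := by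
  cases h; exact ⟨rfl, by assumption⟩

theorem D.fam_cons {n w M x p A K d} (h : D S n emptyCtx w M (.fam x ((p, A) :: K) d)) :
    S p ∧ ∃ n₁ n₂ w₁ w₂ b c, D S n₁ (Function.update emptyCtx x A) w₁ M (.dist b) ∧
      D S n₂ emptyCtx w₂ M (.fam x K c) ∧ n₁ + n₂ ≤ n ∧ w = p * w₁ + w₂ ∧
      d = scaleL p b ++ c := by
  cases h with
  | @fcons _ _ _ _ _ _ Γ₁ _ _ _ _ _ _ _ _ _ p hp h₁ h₂ hn hΓ hw hA hd =>
    obtain ⟨ha, hb⟩ := ctxUnion_eq_empty hΓ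
    have ha := scaleCtx_eq_empty ha
    have e : Γ₁ = Function.update emptyCtx x A := by
      rw [← ha, hA]; simp
    subst e; subst hb
    exact ⟨hp, _, _, _, _, _, _, h₁, h₂, hn, hw, hd⟩

theorem D.fam_mk {n₁ n₂ w₁ w₂ M x p A K b c} (hp : S p)
    (h₁ : D S n₁ (Function.update emptyCtx x A) w₁ M (.dist b))
    (h₂ : D S n₂ emptyCtx w₂ M (.fam x K c)) :
    D S (n₁ + n₂) emptyCtx (p * w₁ + w₂) M (.fam x ((p, A) :: K) (scaleL p b ++ c)) :=
  .fcons p hp h₁ h₂ le_rfl (by simp; rfl) rfl (by simp) rfl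

theorem D.fam_split {M x} {K L : DTy} {n w d} (h : D S n emptyCtx w M (.fam x (K ++ L) d)) :
    ∃ n₁ n₂ w₁ w₂ b c, D S n₁ emptyCtx w₁ M (.fam x K b) ∧
      D S n₂ emptyCtx w₂ M (.fam x L c) ∧ n₁ + n₂ ≤ n ∧ w = w₁ + w₂ ∧ d = b ++ c := by
  induction K generalizing n w d with
  | nil => exact ⟨0, n, 0, w, [], d, .fnil _ _ rfl rfl, h, by simp, by simp, by simp⟩
  | cons a K ih =>
    obtain ⟨q, T⟩ := a
    obtain ⟨hq, n₁, n₂, w₁, w₂, b, c, h₁, h₂, hn, hw, hd⟩ := D.fam_cons h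
    obtain ⟨m₁, m₂, v₁, v₂, b', c', k₁, k₂, hm, hv, hd'⟩ := ih h₂
    exact ⟨_, _, _, _, _, _, D.fam_mk hq h₁ k₁, k₂, by omega, by rw [hw, hv]; ring,
      by rw [hd, hd']; simp⟩

theorem D.fam_append {M x} {K L : DTy} {n w n' w' b c}
    (h : D S n emptyCtx w M (.fam x K b)) (h' : D S n' emptyCtx w' M (.fam x L c)) :
    ∃ m, D S m emptyCtx (w + w') M (.fam x (K ++ L) (b ++ c)) := by
  induction K generalizing n w b with
  | nil => rw [h.fam_nil.1, h.fam_nil.2]; exact ⟨n', by simpa using h'⟩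
  | cons a A ih =>
    obtain ⟨q, T⟩ := a
    obtain ⟨hq, n₁, n₂, w₁, w₂, b, c, h₁, h₂, hn, hw, hd⟩ := D.fam_cons h
    obtain ⟨m, hm⟩ := ih h₂
    have := D.fam_mk hq h₁ hm
    exact ⟨_, by rw [hw, hd, add_assoc, List.append_assoc]; exact this⟩

theorem D.fam_scale {M x} {K : DTy} {n w b p} (hp : ∀ q, S q → S (p * q))
    (h : D S n emptyCtx w M (.fam x K b)) :
    ∃ m, D S m emptyCtx (p * w) M (.fam x (scaleL p K) (scaleL p b)) := by
  induction K generalizing n w b with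
  | nil => rw [h.fam_nil.1, h.fam_nil.2]; exact ⟨0, .fnil _ _ rfl (by simp)⟩
  | cons a A ih =>
    obtain ⟨q, T⟩ := a
    obtain ⟨hq, n₁, n₂, w₁, w₂, b, c, h₁, h₂, hn, hw, hd⟩ := D.fam_cons h
    obtain ⟨m, hm⟩ := ih h₂
    have := D.fam_mk (hp _ hq) h₁ hm
    exact ⟨_, by
      rw [hw, hd, mul_add, ← mul_assoc, scaleL_append, scaleL_scaleL]; exact this⟩

theorem D.fam_unscale {M x} {K : DTy} {n w d p} (hS : ∀ q, S q)
    (h : D S n emptyCtx w M (.fam x (scaleL p K) d)) :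
    ∃ v b, D S n emptyCtx v M (.fam x K b) ∧ w = p * v ∧ d = scaleL p b := by
  induction K generalizing n w d with
  | nil => exact ⟨0, [], .fnil _ _ rfl rfl, by simpa using h.fam_nil.2, h.fam_nil.1⟩
  | cons a A ih =>
    obtain ⟨q, T⟩ := a
    obtain ⟨hq, n₁, n₂, w₁, w₂, b, c, h₁, h₂, hn, hw, hd⟩ := D.fam_cons h
    obtain ⟨v, b', hv, hv', hd'⟩ := ih h₂
    exact ⟨_, _, (D.fam_mk (hS q) h₁ hv).mono hn, by rw [hw, hv']; ring,
      by rw [hd, hd']; simp [scaleL_scaleL]⟩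

/-! Closed reduction steps -/

inductive Step1 : Tm → Tm → Prop
  | beta (x : ℕ) (M : Tm) (y : ℕ) (P : Tm) :
      Step1 (.app (.lam x M) (.lam y P)) (substT M x (.lam y P))
  | letval (x y : ℕ) (P M : Tm) :
      Step1 (.letin x (.val (.lam y P)) M) (substT M x (.lam y P))
  | letc {N N'} (x : ℕ) (M : Tm) : Step1 N N' → Step1 (.letin x N M) (.letin x N' M)

inductive Step2 : Tm → Tm → Tm → Prop
  | choice (M N : Tm) : Step2 (.choice M N) M N
  | letc {N N₁ N₂} (x : ℕ) (M : Tm) : Step2 N N₁ N₂ →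
      Step2 (.letin x N M) (.letin x N₁ M) (.letin x N₂ M)

theorem D.let_inv {n w x N M b} (h : D S n emptyCtx w (.letin x N M) (.dist b)) :
    (b = [] ∧ w = 0) ∨ ∃ n₁ n₂ w₁ w₂ K, D S n₁ emptyCtx w₁ N (.dist K) ∧
      D S n₂ emptyCtx w₂ M (.fam x K b) ∧ n₁ + n₂ + 1 ≤ n ∧ w = w₂ + w₁ + 1 := by
  cases h with
  | zero _ hΓ hw => exact Or.inl ⟨rfl, hw⟩
  | letin _ h₁ h₂ hn hΓ hw =>
    obtain ⟨ha, hb⟩ := ctxUnion_eq_empty hΓ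
    subst ha; subst hb
    exact Or.inr ⟨_, _, _, _, _, h₁, h₂, hn, hw⟩

theorem D.let_mk {n₁ n₂ w₁ w₂ K x N M b} (h₁ : D S n₁ emptyCtx w₁ N (.dist K))
    (h₂ : D S n₂ emptyCtx w₂ M (.fam x K b)) :
    D S (n₁ + n₂ + 1) emptyCtx (w₂ + w₁ + 1) (.letin x N M) (.dist b) :=
  .letin x h₁ h₂ le_rfl rfl rfl

theorem D.sound1 (hS : ∀ q, S q) {M M'} (hs : Step1 M M') : ∀ {n w a},
    D S n emptyCtx w M (.dist a) → (a = [] ∧ w = 0) ∨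
      ∃ n' w', n' < n ∧ D S n' emptyCtx w' M' (.dist a) ∧ w = 1 + w' := by
  induction hs with
  | beta x M y P =>
    intro n w a h
    cases h with
    | zero _ hΓ hw => exact Or.inl ⟨rfl, hw⟩
    | app h₁ h₂ hn hΓ hw =>
      obtain ⟨ha, hb⟩ := ctxUnion_eq_empty hΓ
      subst ha; subst hb
      obtain ⟨_, n₁, n₂, w₁, w₂, k₁, k₂, hn', hw'⟩ := D.inter_cons h₁
      have := k₂.inter_nil
      cases k₁ with
      | lam _ hd hn2 hΓ2 hw2 hA =>
        rw [hA] at h₂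
        have := hd.subst (x := x) hS (by simp) _ _ h₂
        rw [← hΓ2] at this
        exact Or.inr ⟨_, _, by omega, this, by subst_vars; ring⟩
  | letval x y P M =>
    intro n w a h
    rcases h.let_inv with h | ⟨n₁, n₂, w₁, w₂, K, h₁, h₂, hn, hw⟩
    · exact Or.inl h
    · right
      cases h₁ with
      | zero _ _ hw' =>
        obtain ⟨rfl, h2⟩ := h₂.fam_nil
        exact ⟨0, 0, by omega, .zero _ rfl rfl, by rw [hw, hw', h2]; ring⟩
      | tval h₁ =>
        obtain ⟨_, m₁, m₂, v₁, v₂, b, c, k₁, k₂, hm, hv, hd⟩ := D.fam_cons h₂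
        obtain ⟨rfl, h2⟩ := k₂.fam_nil
        have := k₁.subst (x := x) hS (by simp) _ _ (by simpa using h₁)
        simp only [Function.update_idem, update_emptyCtx] at this
        have ha : a = b := by simpa using hd
        rw [← ha] at this
        exact ⟨_, _, by omega, this, by rw [hw, hv, h2]; ring⟩
  | letc x M _ ih =>
    intro n w a h
    rcases h.let_inv with h | ⟨n₁, n₂, w₁, w₂, K, h₁, h₂, hn, hw⟩
    · exact Or.inl h
    · right
      rcases ih h₁ with ⟨rfl, h0⟩ | ⟨n', w', hlt, hd, he⟩
      · obtain ⟨rfl, h2⟩ := h₂.fam_nil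
        exact ⟨0, 0, by omega, .zero _ rfl rfl, by rw [hw, h0, h2]; ring⟩
      · exact ⟨_, _, by omega, D.let_mk hd h₂, by rw [hw, he]; ring⟩

theorem D.sound2 (hS : ∀ q, S q) {M M₁ M₂} (hs : Step2 M M₁ M₂) : ∀ {n w a},
    D S n emptyCtx w M (.dist a) → (a = [] ∧ w = 0) ∨
      ∃ n₁ n₂ w₁ w₂ a₁ a₂, n₁ < n ∧ n₂ < n ∧ D S n₁ emptyCtx w₁ M₁ (.dist a₁) ∧
        D S n₂ emptyCtx w₂ M₂ (.dist a₂) ∧ w = 1 + w₁ / 2 + w₂ / 2 ∧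
        a = scaleL (1/2) a₁ ++ scaleL (1/2) a₂ := by
  induction hs with
  | choice M N =>
    intro n w a h
    cases h with
    | zero _ hΓ hw => exact Or.inl ⟨rfl, hw⟩
    | choice h₁ h₂ hn hΓ hw hc =>
      obtain ⟨ha, hb⟩ := ctxUnion_eq_empty hΓ
      have ha := scaleCtx_eq_empty ha
      have hb := scaleCtx_eq_empty hb
      subst ha; subst hb
      exact Or.inr ⟨_, _, _, _, _, _, by omega, by omega, h₁, h₂, by rw [hw]; ring, hc⟩
  | letc x M _ ih =>
    intro n w a h
    rcases h.let_inv with h | ⟨n₁, n₂, w₁, w₂, K, h₁, h₂, hn, hw⟩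
    · exact Or.inl h
    · right
      rcases ih h₁ with ⟨rfl, h0⟩ | ⟨m₁, m₂, v₁, v₂, a₁, a₂, hlt₁, hlt₂, d₁, d₂, he, hK⟩
      · obtain ⟨rfl, h2⟩ := h₂.fam_nil
        exact ⟨0, 0, 0, 0, [], [], by omega, by omega, .zero _ rfl rfl, .zero _ rfl rfl,
          by rw [hw, h0, h2]; ring, by simp⟩
      · subst hK
        obtain ⟨q₁, q₂, u₁, u₂, b, c, f₁, f₂, hq, hu, hd⟩ := D.fam_split h₂
        obtain ⟨t₁, b', g₁, e₁, rfl⟩ := f₁.fam_unscale hS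
        obtain ⟨t₂, c', g₂, e₂, rfl⟩ := f₂.fam_unscale hS
        exact ⟨_, _, _, _, _, _, by omega, by omega, D.let_mk d₁ g₁, D.let_mk d₂ g₂,
          by rw [hw, he, hu, e₁, e₂]; ring, hd⟩

theorem D.complete1 (hhalf : S (1/2)) (hone : S 1) (hmul : ∀ p q, S p → S q → S (p * q))
    {M M'} (hs : Step1 M M') : ∀ {n' w' a}, fvT M = ∅ →
    D S n' emptyCtx w' M' (.dist a) →
      ∃ n w, D S n emptyCtx w M (.dist a) ∧ 1 + w' ≤ w := by
  induction hs with
  | beta x M y P =>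
    intro n' w' a hc h
    simp only [fvT, Finset.union_eq_empty] at hc
    obtain ⟨A, n₁, w₁, m, v, k₁, k₂, e⟩ := h.antisubst hhalf hmul hc.2 M rfl (by simp) (by simp)
    have hl : D S (n₁ + 1) emptyCtx (w₁ + 1) (.val (.lam x M)) (.arrow (.arr A a)) :=
      .lam x k₁ le_rfl (by simp) rfl (by simp)
    have hl' := D.inter_mk hone hl (.bnil (N := 0) _ _ rfl rfl)
    exact ⟨_, _, .app hl' k₂ le_rfl rfl rfl, by linarith⟩
  | letval x y P M =>
    intro n' w' a hc h
    simp only [fvT, Finset.union_eq_empty] at hc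
    obtain ⟨A, n₁, w₁, m, v, k₁, k₂, e⟩ := h.antisubst hhalf hmul hc.1 M rfl (by simp) (by simp)
    have hf := D.fam_mk hone k₁ (.fnil (N := 0) _ _ rfl rfl)
    have := D.let_mk (.tval k₂) hf
    exact ⟨_, _, by simpa using this, by linarith⟩
  | letc x M _ ih =>
    intro n' w' a hc h
    simp only [fvT, Finset.union_eq_empty] at hc
    rcases h.let_inv with ⟨rfl, rfl⟩ | ⟨n₁, n₂, w₁, w₂, K, h₁, h₂, hn, hw⟩
    · exact ⟨_, _, D.let_mk (.zero (N := 0) _ rfl rfl) (.fnil (N := 0) _ _ rfl rfl), by simp⟩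
    · obtain ⟨n, w, hd, hle⟩ := ih hc.1 h₁
      exact ⟨_, _, D.let_mk hd h₂, by linarith⟩

theorem D.let_inv' {n w x N M b} (h : D S n emptyCtx w (.letin x N M) (.dist b)) :
    ∃ n₁ n₂ w₁ w₂ K, D S n₁ emptyCtx w₁ N (.dist K) ∧
      D S n₂ emptyCtx w₂ M (.fam x K b) ∧ w ≤ w₂ + w₁ + 1 := by
  rcases h.let_inv with ⟨rfl, rfl⟩ | ⟨n₁, n₂, w₁, w₂, K, h₁, h₂, hn, hw⟩
  · exact ⟨0, 0, 0, 0, [], .zero _ rfl rfl, .fnil _ _ rfl rfl, by simp⟩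
  · exact ⟨_, _, _, _, _, h₁, h₂, hw.le⟩

theorem D.complete2 (hhalf : S (1/2)) (hmul : ∀ p q, S p → S q → S (p * q))
    {M M₁ M₂} (hs : Step2 M M₁ M₂) : ∀ {n₁ w₁ a₁ n₂ w₂ a₂},
    D S n₁ emptyCtx w₁ M₁ (.dist a₁) → D S n₂ emptyCtx w₂ M₂ (.dist a₂) →
      ∃ n w, D S n emptyCtx w M (.dist (scaleL (1/2) a₁ ++ scaleL (1/2) a₂)) ∧
        1 + w₁ / 2 + w₂ / 2 ≤ w := by
  induction hs with
  | choice M N =>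
    intro n₁ w₁ a₁ n₂ w₂ a₂ h₁ h₂
    exact ⟨_, _, .choice h₁ h₂ le_rfl rfl rfl rfl, by linarith⟩
  | letc x M _ ih =>
    intro n₁ w₁ a₁ n₂ w₂ a₂ h₁ h₂
    obtain ⟨_, _, v₁, u₁, K₁, k₁, f₁, e₁⟩ := h₁.let_inv'
    obtain ⟨_, _, v₂, u₂, K₂, k₂, f₂, e₂⟩ := h₂.let_inv'
    obtain ⟨n, w, hd, hle⟩ := ih k₁ k₂
    obtain ⟨_, f₁⟩ := f₁.fam_scale (p := 1/2) (fun q => hmul _ q hhalf)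
    obtain ⟨_, f₂⟩ := f₂.fam_scale (p := 1/2) (fun q => hmul _ q hhalf)
    obtain ⟨_, f⟩ := f₁.fam_append f₂
    exact ⟨_, _, D.let_mk hd f, by linarith⟩

end Aux

mutual
theorem fvV_subst : ∀ (W : Val) (x : ℕ) (V : Val), fvV V = ∅ → fvV (substV W x V) ⊆ fvV W \ {x}
  | .var y, x, V, h => by
      simp only [substV]; split_ifs with hy
      · simp [h]
      · simp [fvV, hy]
  | .lam y M, x, V, h => by
      simp only [substV]; split_ifs with hy
      · intro z; simp [fvV, hy]
      · have ih := fvT_subst M x V h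
        intro z hz
        simp only [fvV, Finset.mem_sdiff, Finset.mem_singleton] at hz ⊢
        have := ih hz.1
        simp only [Finset.mem_sdiff, Finset.mem_singleton] at this
        tauto
theorem fvT_subst : ∀ (M : Tm) (x : ℕ) (V : Val), fvV V = ∅ → fvT (substT M x V) ⊆ fvT M \ {x}
  | .val W, x, V, h => by simpa only [substT, fvT] using fvV_subst W x V h
  | .app W U, x, V, h => by
      have h1 := fvV_subst W x V h
      have h2 := fvV_subst U x V h
      intro z hz
      simp only [substT, fvT, Finset.mem_union] at hz
      have h1 := @h1 z
      have h2 := @h2 z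
      simp only [fvT, Finset.mem_sdiff, Finset.mem_singleton, Finset.mem_union] at h1 h2 ⊢
      tauto
  | .choice M N, x, V, h => by
      have h1 := fvT_subst M x V h
      have h2 := fvT_subst N x V h
      intro z hz
      simp only [substT, fvT, Finset.mem_union] at hz
      have h1 := @h1 z
      have h2 := @h2 z
      simp only [fvT, Finset.mem_sdiff, Finset.mem_singleton, Finset.mem_union] at h1 h2 ⊢
      tauto
  | .letin y N M, x, V, h => by
      have h1 := fvT_subst N x V h
      have h2 := fvT_subst M x V h
      intro z hz
      have h1 := @h1 z
      have h2 := @h2 z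
      simp only [substT] at hz
      split_ifs at hz with hy <;>
      simp only [fvT, Finset.mem_sdiff, Finset.mem_singleton, Finset.mem_union] at h1 h2 hz ⊢
      · subst hy; tauto
      · tauto
end

theorem closed_lam {V : Val} (h : fvV V = ∅) : ∃ y P, V = .lam y P := by
  cases V with
  | var x => simp [fvV] at h
  | lam y P => exact ⟨y, P, rfl⟩

theorem closed_subst {M : Tm} {x : ℕ} {V : Val} (hV : fvV V = ∅) (hM : fvT M \ {x} = ∅) :
    fvT (substT M x V) = ∅ :=
  Finset.subset_empty.1 (hM ▸ fvT_subst M x V hV)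

theorem progress : ∀ (M : Tm), fvT M = ∅ → (∃ V, M = .val V) ∨
    (∃ M', Step1 M M' ∧ fvT M' = ∅) ∨
    (∃ M₁ M₂, Step2 M M₁ M₂ ∧ fvT M₁ = ∅ ∧ fvT M₂ = ∅)
  | .val V, _ => Or.inl ⟨V, rfl⟩
  | .app V W, h => by
      simp only [fvT, Finset.union_eq_empty] at h
      obtain ⟨x, M, rfl⟩ := closed_lam h.1
      obtain ⟨y, P, rfl⟩ := closed_lam h.2
      exact Or.inr (Or.inl ⟨_, .beta x M y P, closed_subst h.2 (by simpa [fvV] using h.1)⟩)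
  | .choice M N, h => by
      simp only [fvT, Finset.union_eq_empty] at h
      exact Or.inr (Or.inr ⟨_, _, .choice M N, h.1, h.2⟩)
  | .letin x N M, h => by
      simp only [fvT, Finset.union_eq_empty] at h
      rcases progress N h.1 with ⟨V, rfl⟩ | ⟨N', hs, hc⟩ | ⟨N₁, N₂, hs, hc₁, hc₂⟩
      · have hV : fvV V = ∅ := by simpa [fvT] using h.1
        obtain ⟨y, P, rfl⟩ := closed_lam hV
        exact Or.inr (Or.inl ⟨_, .letval x y P M, closed_subst hV h.2⟩)
      · exact Or.inr (Or.inl ⟨_, .letc x M hs, by simp only [fvT, hc, h.2, Finset.union_empty]⟩)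
      · exact Or.inr (Or.inr ⟨_, _, .letc x M hs, by simp only [fvT, hc₁, h.2, Finset.union_empty],
          by simp only [fvT, hc₂, h.2, Finset.union_empty]⟩)

theorem Step1.stepF {M M'} (h : Step1 M M') : stepF M = {(1, M')} := by
  induction h with
  | beta x M y P => simp [CbV.stepF]
  | letval x y P M => simp [CbV.stepF]
  | @letc N N' x M hs ih =>
    rw [CbV.stepF, ih]
    · simp
    · rintro V rfl; cases hs

theorem Step2.stepF {M M₁ M₂} (h : Step2 M M₁ M₂) : stepF M = {(1/2, M₁), (1/2, M₂)} := by
  induction h with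
  | choice M N => simp [CbV.stepF]
  | @letc N N₁ N₂ x M hs ih =>
    rw [CbV.stepF, ih]
    · simp
    · rintro V rfl; cases hs

theorem scaleM_add (q : ℚ) (m m' : MDist) : scaleM q (m + m') = scaleM q m + scaleM q m' := by
  simp [scaleM]

theorem scaleM_scaleM (p q : ℚ) (m : MDist) : scaleM p (scaleM q m) = scaleM (p * q) m := by
  simp [scaleM, mul_assoc]

theorem mstepF_add (m m' : MDist) : mstepF (m + m') = mstepF m + mstepF m' := by
  simp [mstepF]

theorem mstepF_scale (q : ℚ) (m : MDist) : mstepF (scaleM q m) = scaleM q (mstepF m) := by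
  induction m using Multiset.induction_on with
  | empty => simp [mstepF, scaleM]
  | cons a m ih =>
    rw [← Multiset.singleton_add, scaleM_add, mstepF_add, mstepF_add, scaleM_add, ih]
    congr 1
    simp [mstepF, scaleM, mul_assoc]

theorem normV_add (m m' : MDist) : normV (m + m') = normV m + normV m' := by
  simp [normV]

theorem normV_scale (q : ℚ) (m : MDist) : normV (scaleM q m) = q * normV m := by
  induction m using Multiset.induction_on with
  | empty => simp [normV, scaleM]
  | cons a m ih =>
    rw [← Multiset.singleton_add, scaleM_add, normV_add, normV_add, ih, mul_add]
    congr 1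
    by_cases h : a.2.isVal = true <;> simp [normV, scaleM, h, Multiset.filter_singleton]

theorem iter_add (k : ℕ) (m m' : MDist) :
    mstepF^[k] (m + m') = mstepF^[k] m + mstepF^[k] m' := by
  induction k generalizing m m' with
  | zero => rfl
  | succ k ih => simp only [Function.iterate_succ, Function.comp, mstepF_add, ih]

theorem iter_scale (k : ℕ) (q : ℚ) (m : MDist) :
    mstepF^[k] (scaleM q m) = scaleM q (mstepF^[k] m) := by
  induction k generalizing m with
  | zero => rfl
  | succ k ih => simp only [Function.iterate_succ, Function.comp, mstepF_scale, ih]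

theorem mstepF_single (M : Tm) : mstepF {(1, M)} = stepF M := by
  simp [mstepF, scaleM]

theorem normV_single (M : Tm) : normV {(1, M)} = if M.isVal = true then 1 else 0 := by
  unfold normV
  rw [Multiset.filter_singleton]
  split_ifs <;> simp

theorem evalP_val (k : ℕ) (V : Val) : evalP k (.val V) = 1 := by
  have : traj (.val V) k = {(1, .val V)} := by
    induction k with
    | zero => rfl
    | succ k ih =>
      unfold traj at *
      rw [Function.iterate_succ, Function.comp, mstepF_single, stepF, ih]
  rw [evalP, this, normV_single]; simp [Tm.isVal]

theorem evalP_step1 {M M'} (h : Step1 M M') (k : ℕ) : evalP (k + 1) M = evalP k M' := by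
  simp [evalP, traj, mstepF_single, h.stepF]

theorem evalP_step2 {M M₁ M₂} (h : Step2 M M₁ M₂) (k : ℕ) :
    evalP (k + 1) M = evalP k M₁ / 2 + evalP k M₂ / 2 := by
  have e : ({(1/2, M₁), (1/2, M₂)} : MDist)
      = scaleM (1/2) {(1, M₁)} + scaleM (1/2) {(1, M₂)} := by
    simp [scaleM]
  simp only [evalP, traj, Function.iterate_succ, Function.comp, mstepF_single, h.stepF]
  rw [e, iter_add, iter_scale, iter_scale, normV_add, normV_scale, normV_scale]
  ring

theorem evalP_zero1 {M M'} (h : Step1 M M') : evalP 0 M = 0 := by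
  cases h <;> simp [evalP, traj, normV_single, Tm.isVal]

theorem evalP_zero2 {M M₁ M₂} (h : Step2 M M₁ M₂) : evalP 0 M = 0 := by
  cases h <;> simp [evalP, traj, normV_single, Tm.isVal]

theorem etime_val (n : ℕ) (V : Val) : etime n (.val V) = 0 := by
  simp [etime, evalP_val]

theorem etime_step1 {M M'} (h : Step1 M M') (n : ℕ) : etime (n + 1) M = 1 + etime n M' := by
  simp only [etime, Finset.sum_range_succ', evalP_step1 h, evalP_zero1 h]; ring

theorem etime_step2 {M M₁ M₂} (h : Step2 M M₁ M₂) (n : ℕ) :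
    etime (n + 1) M = 1 + etime n M₁ / 2 + etime n M₂ / 2 := by
  simp only [etime, Finset.sum_range_succ', evalP_step2 h, evalP_zero2 h]
  rw [Finset.sum_div, Finset.sum_div, add_assoc, ← Finset.sum_add_distrib, add_comm]
  congr 1
  · ring
  · exact Finset.sum_congr rfl fun _ _ => by ring

theorem evalP_le (k : ℕ) : ∀ M : Tm, fvT M = ∅ → evalP k M ≤ 1 := by
  induction k with
  | zero =>
    intro M h
    rcases progress M h with ⟨V, rfl⟩ | ⟨N', hs, hc⟩ | ⟨N₁, N₂, hs, hc₁, hc₂⟩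
    · rw [evalP_val]
    · rw [evalP_zero1 hs]; norm_num
    · rw [evalP_zero2 hs]; norm_num
  | succ k ih =>
    intro M h
    rcases progress M h with ⟨V, rfl⟩ | ⟨N', hs, hc⟩ | ⟨N₁, N₂, hs, hc₁, hc₂⟩
    · rw [evalP_val]
    · rw [evalP_step1 hs]; exact ih _ hc
    · rw [evalP_step2 hs]; linarith [ih _ hc₁, ih _ hc₂]

theorem etime_mono {M : Tm} (h : fvT M = ∅) {m n : ℕ} (hmn : m ≤ n) : etime m M ≤ etime n M :=
  Finset.sum_le_sum_of_subset_of_nonneg (Finset.range_mono hmn)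
    fun k _ _ => sub_nonneg.2 (evalP_le k M h)

theorem etime_nonneg {M : Tm} (h : fvT M = ∅) (n : ℕ) : 0 ≤ etime n M :=
  Finset.sum_nonneg fun k _ => sub_nonneg.2 (evalP_le k M h)

def STop : ℚ → Prop := fun _ => True
def SUnit : ℚ → Prop := fun q => 0 < q ∧ q ≤ 1

theorem soundness (n : ℕ) : ∀ (M : Tm) (w : ℚ), fvT M = ∅ →
    D STop n emptyCtx w M (.dist []) → w ≤ etime n M := by
  have hS : ∀ q, STop q := fun _ => trivial
  induction n using Nat.strong_induction_on with
  | _ n ih =>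
    intro M w hM h
    rcases progress M hM with ⟨V, rfl⟩ | ⟨N', hs, hc⟩ | ⟨N₁, N₂, hs, hc₁, hc₂⟩
    · cases h with
      | zero _ _ hw => rw [hw]; exact etime_nonneg hM n
    · rcases h.sound1 hS hs with ⟨_, hw⟩ | ⟨n', w', hlt, hd, hw⟩
      · rw [hw]; exact etime_nonneg hM n
      · obtain ⟨k, rfl⟩ : ∃ k, n = k + 1 := ⟨n - 1, by omega⟩
        rw [etime_step1 hs, hw]
        linarith [ih _ hlt _ _ hc hd, etime_mono hc (show n' ≤ k by omega)]
    · rcases h.sound2 hS hs with ⟨_, hw⟩ | ⟨n₁, n₂, w₁, w₂, a₁, a₂, hlt₁, hlt₂, d₁, d₂, hw, ha⟩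
      · rw [hw]; exact etime_nonneg hM n
      · obtain ⟨k, rfl⟩ : ∃ k, n = k + 1 := ⟨n - 1, by omega⟩
        have ha := ha.symm
        simp only [List.append_eq_nil_iff, scaleL_eq_nil] at ha
        obtain ⟨rfl, rfl⟩ := ha
        rw [etime_step2 hs, hw]
        linarith [ih _ (by omega) _ _ hc₁ d₁, etime_mono hc₁ (show n₁ ≤ k by omega),
          ih _ (by omega) _ _ hc₂ d₂, etime_mono hc₂ (show n₂ ≤ k by omega)]

theorem completeness (n : ℕ) : ∀ (M : Tm), fvT M = ∅ →
    ∃ m w, D SUnit m emptyCtx w M (.dist []) ∧ etime n M ≤ w := by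
  have hhalf : SUnit (1/2) := by norm_num [SUnit]
  have hone : SUnit 1 := by norm_num [SUnit]
  have hmul : ∀ p q, SUnit p → SUnit q → SUnit (p * q) := fun p q hp hq =>
    ⟨mul_pos hp.1 hq.1, mul_le_one₀ hp.2 hq.1.le hq.2⟩
  induction n with
  | zero => intro M _; exact ⟨0, 0, .zero _ rfl rfl, by simp [etime]⟩
  | succ n ih =>
    intro M hM
    rcases progress M hM with ⟨V, rfl⟩ | ⟨N', hs, hc⟩ | ⟨N₁, N₂, hs, hc₁, hc₂⟩
    · exact ⟨0, 0, .zero _ rfl rfl, by rw [etime_val]⟩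
    · obtain ⟨m, w, hd, hw⟩ := ih _ hc
      obtain ⟨m', w', hd', hw'⟩ := hd.complete1 hhalf hone hmul hs hM
      exact ⟨_, _, hd', by rw [etime_step1 hs]; linarith⟩
    · obtain ⟨m₁, w₁, hd₁, hw₁⟩ := ih _ hc₁
      obtain ⟨m₂, w₂, hd₂, hw₂⟩ := ih _ hc₂
      obtain ⟨m', w', hd', hw'⟩ := hd₁.complete2 hhalf hmul hs hd₂
      exact ⟨_, _, by simpa using hd', by rw [etime_step2 hs]; linarith⟩

/-! Translations between the two systems -/

def toJ : Ty → Jt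
  | .arrow T => .arrow T
  | .inter A => .inter A
  | .dist b => .dist b

theorem ofDeriv {Γ w M τ} (d : Deriv Γ w M τ) : ∃ n, D STop n Γ w M (toJ τ) := by
  induction d with
  | var x A => exact ⟨0, .var x A rfl rfl⟩
  | zero M => exact ⟨0, .zero M rfl rfl⟩
  | lam x b _ ih =>
    obtain ⟨n, h⟩ := ih
    exact ⟨n + 1, .lam x h le_rfl rfl rfl rfl⟩
  | app _ _ ih1 ih2 =>
    obtain ⟨n, h⟩ := ih1
    obtain ⟨m, k⟩ := ih2
    exact ⟨n + m, .app h k le_rfl rfl rfl⟩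
  | choice _ _ ih1 ih2 =>
    obtain ⟨n, h⟩ := ih1
    obtain ⟨m, k⟩ := ih2
    exact ⟨n + m + 1, .choice h k le_rfl rfl rfl rfl⟩
  | @letin Γ v x N M K hK f e ih1 ih2 =>
    obtain ⟨n, h⟩ := ih2
    have hf : ∀ k ∈ K, ∃ n, D STop n (Function.update k.2.2.1 x k.2.1) k.2.2.2.1 M
        (.dist k.2.2.2.2) := by
      intro k hk
      obtain ⟨i, rfl⟩ := List.mem_iff_get.1 hk
      exact ih1 i
    have key : ∃ m, D STop m (fun y => (K.map fun k => scaleL k.1 (k.2.2.1 y)).flatten)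
        ((K.map fun k => k.1 * k.2.2.2.1).sum) M
        (.fam x (K.map fun k => (k.1, k.2.1)) (K.map fun k => scaleL k.1 k.2.2.2.2).flatten) := by
      clear ih1 h f e
      induction K with
      | nil => exact ⟨0, .fnil _ _ rfl rfl⟩
      | cons k K ih =>
        obtain ⟨m, hm⟩ := ih (fun k hk => hK k (List.mem_cons_of_mem _ hk))
          (fun k hk => hf k (List.mem_cons_of_mem _ hk))
        obtain ⟨n, hn⟩ := hf k List.mem_cons_self
        have hx := hK k List.mem_cons_self
        refine ⟨n + m, .fcons k.1 trivial hn hm le_rfl ?_ (by simp) (by simp) (by simp)⟩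
        rw [Function.update_idem, ← hx, Function.update_eq_self]
        funext y
        simp
    obtain ⟨m, k⟩ := key
    exact ⟨n + m + 1, .letin x h k le_rfl rfl rfl⟩
  | tval _ ih =>
    obtain ⟨n, h⟩ := ih
    exact ⟨n, .tval h⟩
  | @bang V I hI f ih =>
    have hf : ∀ k ∈ I, ∃ n, D STop n k.2.1 k.2.2.1 (.val V) (.arrow k.2.2.2) := by
      intro k hk
      obtain ⟨i, rfl⟩ := List.mem_iff_get.1 hk
      exact ih i
    clear ih f hI
    cases V with
    | var y =>
      cases I with
      | nil => exact ⟨0, .var y [] (by simp; rfl) rfl⟩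
      | cons k I =>
        obtain ⟨n, hn⟩ := hf k List.mem_cons_self
        cases hn
    | lam y P =>
      induction I with
      | nil => exact ⟨0, .bnil _ _ rfl rfl⟩
      | cons k I ih =>
        obtain ⟨m, hm⟩ := ih (fun k hk => hf k (List.mem_cons_of_mem _ hk))
        obtain ⟨n, hn⟩ := hf k List.mem_cons_self
        refine ⟨n + m, .bcons k.1 trivial hn hm le_rfl ?_ (by simp)⟩
        funext y
        simp

def Interp (Γ : Ctx) (w : ℚ) (M : Tm) : Jt → Prop
  | .arrow T => Nonempty (Deriv Γ w M (.arrow T))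
  | .dist b => Nonempty (Deriv Γ w M (.dist b))
  | .inter A => ∃ V, M = .val V ∧
      ((∃ y, V = .var y ∧ Γ = Function.update emptyCtx y A ∧ w = 0) ∨
       ∃ I : List (ℚ × Ctx × ℚ × ATy), (∀ k ∈ I, 0 < k.1 ∧ k.1 ≤ 1) ∧
        (∀ k ∈ I, Nonempty (Deriv k.2.1 k.2.2.1 (.val V) (.arrow k.2.2.2))) ∧
        Γ = (fun y => (I.map fun k => scaleL k.1 (k.2.1 y)).flatten) ∧
        w = (I.map fun k => k.1 * k.2.2.1).sum ∧ A = I.map fun k => (k.1, k.2.2.2))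
  | .fam x K b => ∃ L : List (ℚ × ITy × Ctx × ℚ × DTy), (∀ k ∈ L, k.2.2.1 x = []) ∧
      (∀ k ∈ L, Nonempty (Deriv (Function.update k.2.2.1 x k.2.1) k.2.2.2.1 M
        (.dist k.2.2.2.2))) ∧
      Γ = (fun y => (L.map fun k => scaleL k.1 (k.2.2.1 y)).flatten) ∧
      w = (L.map fun k => k.1 * k.2.2.2.1).sum ∧ K = (L.map fun k => (k.1, k.2.1)) ∧
      b = (L.map fun k => scaleL k.1 k.2.2.2.2).flatten

theorem Interp.inter {Γ w M A} (h : Interp Γ w M (.inter A)) :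
    Nonempty (Deriv Γ w M (.inter A)) := by
  obtain ⟨V, rfl, ⟨y, rfl, rfl, rfl⟩ | ⟨I, h1, h2, rfl, rfl, rfl⟩⟩ := h
  · exact ⟨.var y A⟩
  · exact ⟨.bang I h1 fun i => Classical.choice (h2 _ (List.get_mem _ _))⟩

theorem toDeriv {n Γ w M τ} (h : D SUnit n Γ w M τ) : Interp Γ w M τ := by
  induction h with
  | var x A hΓ hw => exact ⟨_, rfl, Or.inl ⟨x, rfl, hΓ, hw⟩⟩
  | zero M hΓ hw => subst hΓ; subst hw; exact ⟨.zero M⟩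
  | lam x hd hn hΓ hw hA ih =>
    obtain ⟨d⟩ := ih
    subst hΓ; subst hw; subst hA
    exact ⟨.lam x _ d⟩
  | app _ _ hn hΓ hw ih1 ih2 =>
    obtain ⟨d⟩ := ih1.inter
    obtain ⟨e⟩ := ih2.inter
    subst hΓ; subst hw
    exact ⟨.app d e⟩
  | choice _ _ hn hΓ hw hc ih1 ih2 =>
    obtain ⟨d⟩ := ih1
    obtain ⟨e⟩ := ih2
    subst hΓ; subst hw; subst hc
    exact ⟨.choice d e⟩
  | letin x _ _ hn hΓ hw ih1 ih2 =>
    obtain ⟨L, h1, h2, rfl, rfl, rfl, rfl⟩ := ih2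
    obtain ⟨d⟩ := ih1
    subst hΓ; subst hw
    exact ⟨.letin x L h1 (fun i => Classical.choice (h2 _ (List.get_mem _ _))) d⟩
  | tval _ ih =>
    obtain ⟨d⟩ := ih.inter
    exact ⟨.tval d⟩
  | bnil y M hΓ hw =>
    subst hΓ; subst hw
    exact ⟨_, rfl, Or.inr ⟨[], by simp, by simp, rfl, rfl, rfl⟩⟩
  | @bcons N Γ w n m Γ₁ Γ₂ w₁ w₂ y M T A q hq _ _ hn hΓ hw ih1 ih2 =>
    obtain ⟨V, hV, ⟨y', rfl, _⟩ | ⟨I, h1, h2, rfl, rfl, rfl⟩⟩ := ih2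
    · simp at hV
    · cases hV
      subst hΓ; subst hw
      refine ⟨_, rfl, Or.inr ⟨(q, Γ₁, w₁, T) :: I, ?_, ?_, ?_, by simp, by simp⟩⟩
      · intro k hk
        rcases List.mem_cons.1 hk with rfl | hk
        · exact hq
        · exact h1 k hk
      · intro k hk
        rcases List.mem_cons.1 hk with rfl | hk
        · exact ih1
        · exact h2 k hk
      · funext z; simp
  | fnil x M hΓ hw =>
    subst hΓ; subst hw
    exact ⟨[], by simp, by simp, rfl, rfl, rfl, rfl⟩
  | @fcons N Γ w d n m Γ₁ Γ₂ w₁ w₂ x M b K c A p hp _ _ hn hΓ hw hA hd ih1 ih2 =>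
    obtain ⟨L, h1, h2, rfl, rfl, rfl, rfl⟩ := ih2
    subst hΓ; subst hw; subst hA; subst hd
    refine ⟨(p, Γ₁ x, Function.update Γ₁ x [], w₁, b) :: L, ?_, ?_, ?_, by simp, by simp, by simp⟩
    · intro k hk
      rcases List.mem_cons.1 hk with rfl | hk
      · simp
      · exact h1 k hk
    · intro k hk
      rcases List.mem_cons.1 hk with rfl | hk
      · have ih1 : Nonempty (Deriv Γ₁ w₁ M (.dist b)) := ih1
        simpa using ih1
      · exact h2 k hk
    · funext z; simp

theorem ETime_eq {M : Tm} (hM : fvT M = ∅) :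
    ETime M = ⨆ n : ℕ, ENNReal.ofReal ((etime n M : ℚ) : ℝ) := by
  rw [ETime, ENNReal.tsum_eq_iSup_nat]
  congr 1
  funext n
  rw [etime, Rat.cast_sum, ENNReal.ofReal_sum_of_nonneg]
  · exact Finset.sum_congr rfl fun k _ => by push_cast; rfl
  · intro k _
    exact_mod_cast sub_nonneg.2 (evalP_le k M hM)

theorem ETime_eq_sSup {M : Tm} (hM : fvT M = ∅) :
    ETime M = sSup {x : ℝ≥0∞ | ∃ w : ℚ,
        Nonempty (Deriv emptyCtx w M (.dist [])) ∧
        x = ENNReal.ofReal ((w : ℚ) : ℝ)} := by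
  rw [ETime_eq hM]
  apply le_antisymm
  · refine iSup_le fun n => ?_
    obtain ⟨m, w, hd, hw⟩ := completeness n M hM
    exact le_trans (ENNReal.ofReal_le_ofReal (by exact_mod_cast hw))
      (le_sSup ⟨w, toDeriv hd, rfl⟩)
  · refine sSup_le ?_
    rintro _ ⟨w, ⟨d⟩, rfl⟩
    obtain ⟨n, hn⟩ := ofDeriv d
    exact le_iSup_of_le n
      (ENNReal.ofReal_le_ofReal (by exact_mod_cast soundness n M w hM hn))

/-- **Null Typing, Expected Runtimes, and PAST**: `ETime(M)` equals the sup
of the weights of null typings of `M` (in `[0,∞]`); consequently `M` is PAST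
iff that sup is finite. -/
theorem null_typing_expected_runtime {M : Tm} (hM : M.Closed) :
    ETime M = sSup {x : ℝ≥0∞ | ∃ w : ℚ,
        Nonempty (Deriv emptyCtx w M (.dist [])) ∧
        x = ENNReal.ofReal ((w : ℚ) : ℝ)} ∧
    (ETime M < ⊤ ↔
      sSup {x : ℝ≥0∞ | ∃ w : ℚ,
        Nonempty (Deriv emptyCtx w M (.dist [])) ∧
        x = ENNReal.ofReal ((w : ℚ) : ℝ)} < ⊤) := by
  have h := ETime_eq_sSup hM
  exact ⟨h, by rw [h]⟩

end CbV
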